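/- For every p ∈ [1,∞) there is a constant C = C(p) such that for every n ≥ 2, every real Banach space X, and every F : {-1,1}^n × {-1,1}^n → X, setting F_j(ε) := E_δ[δ_j F(ε,δ)] for j = 1,…,n, one has (E_ε‖Σ_{j=1}^n Δ^{-1} D_j F_j‖_X^p)^{1/p} ≤ C · n · log n · (E_{δ,ε}‖F(ε,δ)‖_X^p)^{1/p}. -/

import Mathlib

open scoped BigOperators
open Finset

noncomputable section

/-- The ±1 value of a Boolean coordinate. -/
def rad (b : Bool) : ℝ := if b then 1 else -1

/-- Expectation over the uniform measure on the discrete cube `{-1,1}^n`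
(points encoded as `Fin n → Bool`). -/
def cubeAvg {n : ℕ} {X : Type*} [AddCommGroup X] [Module ℝ X]
    (f : (Fin n → Bool) → X) : X :=
  ((2 ^ n : ℝ)⁻¹) • ∑ ε : Fin n → Bool, f ε

/-- Walsh character `w_A(ε) = ∏_{i ∈ A} ε_i`. -/
def walshChar {n : ℕ} (A : Finset (Fin n)) (ε : Fin n → Bool) : ℝ :=
  ∏ i ∈ A, rad (ε i)

/-- Walsh coefficient `f̂(A) = E_ε [f(ε) w_A(ε)]`. -/
def wcoef {n : ℕ} {X : Type*} [AddCommGroup X] [Module ℝ X]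
    (f : (Fin n → Bool) → X) (A : Finset (Fin n)) : X :=
  cubeAvg (fun ε => walshChar A ε • f ε)

/-- Flip the `j`-th coordinate. -/
def flipCoord {n : ℕ} (j : Fin n) (ε : Fin n → Bool) : Fin n → Bool :=
  Function.update ε j (!(ε j))

/-- Discrete derivative `D_j f(ε) = (f(ε) - f(σ_j ε))/2`. -/
def Dop {n : ℕ} {X : Type*} [AddCommGroup X] [Module ℝ X]
    (j : Fin n) (f : (Fin n → Bool) → X) : (Fin n → Bool) → X :=
  fun ε => (2 : ℝ)⁻¹ • (f ε - f (flipCoord j ε))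

/-- Heat semigroup `P_t f = Σ_A e^{-t|A|} f̂(A) w_A`. -/
def heatOp {n : ℕ} {X : Type*} [AddCommGroup X] [Module ℝ X]
    (t : ℝ) (f : (Fin n → Bool) → X) : (Fin n → Bool) → X :=
  fun ε => ∑ A : Finset (Fin n), (Real.exp (-t * A.card) * walshChar A ε) • wcoef f A

/-- Fractional power of the Laplacian on mean-zero parts:
`Δ^a f = Σ_{A ≠ ∅} |A|^a f̂(A) w_A`. -/
def lapPow {n : ℕ} {X : Type*} [AddCommGroup X] [Module ℝ X]
    (a : ℝ) (f : (Fin n → Bool) → X) : (Fin n → Bool) → X :=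
  fun ε => ∑ A ∈ Finset.univ.filter (fun A : Finset (Fin n) => A ≠ ∅),
    (((A.card : ℝ)) ^ a * walshChar A ε) • wcoef f A

/-- `X` has cotype `q` with constant `K`. -/
def HasCotypeConst (X : Type*) [NormedAddCommGroup X] [NormedSpace ℝ X] (q K : ℝ) : Prop :=
  ∀ m : ℕ, ∀ x : Fin m → X,
    (∑ j, ‖x j‖ ^ q) ^ (1 / q) ≤
      K * (cubeAvg (fun δ : Fin m → Bool => ‖∑ j, rad (δ j) • x j‖ ^ (2 : ℝ))) ^ (1 / 2 : ℝ)

/-- `X` has type `s` with constant `T`. -/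
def HasTypeConst (X : Type*) [NormedAddCommGroup X] [NormedSpace ℝ X] (s T : ℝ) : Prop :=
  ∀ m : ℕ, ∀ x : Fin m → X,
    (cubeAvg (fun δ : Fin m → Bool => ‖∑ j, rad (δ j) • x j‖ ^ (2 : ℝ))) ^ (1 / 2 : ℝ) ≤
      T * (∑ j, ‖x j‖ ^ s) ^ (1 / s)

/-! ### Helper lemmas -/

/-- Coordinatewise product of two points of the cube. -/
def mulPt {n : ℕ} (ε η : Fin n → Bool) : Fin n → Bool := fun i => ε i == η i

lemma rad_beq (a b : Bool) : rad (a == b) = rad a * rad b := by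
  cases a <;> cases b <;> simp [rad]

lemma abs_rad (a : Bool) : |rad a| = 1 := by
  cases a <;> simp [rad]

lemma mulPt_comm {n : ℕ} (ε η : Fin n → Bool) : mulPt ε η = mulPt η ε := by
  funext i; simp only [mulPt]; cases ε i <;> cases η i <;> rfl

lemma mulPt_mulPt {n : ℕ} (ε η : Fin n → Bool) : mulPt ε (mulPt ε η) = η := by
  funext i; simp only [mulPt]; cases ε i <;> cases η i <;> rfl

/-- Multiplication by a point, as a permutation. -/
def mulEquiv {n : ℕ} (ε : Fin n → Bool) : (Fin n → Bool) ≃ (Fin n → Bool) :=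
  ⟨mulPt ε, mulPt ε, mulPt_mulPt ε, mulPt_mulPt ε⟩

lemma flipCoord_flipCoord {n : ℕ} (j : Fin n) (ε : Fin n → Bool) :
    flipCoord j (flipCoord j ε) = ε := by
  simp [flipCoord]

/-- Flipping, as a permutation. -/
def flipEquiv {n : ℕ} (j : Fin n) : (Fin n → Bool) ≃ (Fin n → Bool) :=
  ⟨flipCoord j, flipCoord j, flipCoord_flipCoord j, flipCoord_flipCoord j⟩

lemma walshChar_mulPt {n : ℕ} (A : Finset (Fin n)) (ε η : Fin n → Bool) :
    walshChar A (mulPt ε η) = walshChar A ε * walshChar A η := by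
  simp [walshChar, mulPt, rad_beq, Finset.prod_mul_distrib]

/-- The kernel of the inverse Laplacian. -/
def kerL {n : ℕ} (ε : Fin n → Bool) : ℝ :=
  ∑ A ∈ Finset.univ.filter (fun A : Finset (Fin n) => A ≠ ∅),
    (A.card : ℝ)⁻¹ * walshChar A ε

/-- The derivative kernel. -/
def kerQ {n : ℕ} (r : ℝ) (ε : Fin n → Bool) : ℝ :=
  ∑ A ∈ Finset.univ.filter (fun A : Finset (Fin n) => A ≠ ∅),
    r ^ (A.card - 1) * walshChar A ε

lemma kerQ_cont {n : ℕ} (ε : Fin n → Bool) : Continuous (fun r => kerQ r ε) := by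
  unfold kerQ; fun_prop

lemma kerL_eq {n : ℕ} (ε : Fin n → Bool) : kerL ε = ∫ r in (0:ℝ)..1, kerQ r ε := by
  unfold kerL kerQ
  rw [intervalIntegral.integral_finset_sum]
  · refine Finset.sum_congr rfl fun A hA => ?_
    have hc : A.card ≠ 0 := by simpa using hA
    rw [intervalIntegral.integral_mul_const, integral_pow]
    congr 1
    have : ((A.card - 1 : ℕ) : ℝ) + 1 = A.card := by
      norm_cast; omega
    rw [this]
    have h2 : A.card - 1 + 1 = A.card := by omega
    rw [h2]; simp [hc]
  · intro A _
    exact Continuous.intervalIntegrable (by fun_prop) _ _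

lemma mul_kerQ {n : ℕ} (r : ℝ) (ε : Fin n → Bool) :
    r * kerQ r ε = ∏ i, (1 + r * rad (ε i)) - 1 := by
  rw [Finset.prod_one_add, Finset.powerset_univ,
    ← Finset.sum_filter_add_sum_filter_not Finset.univ (fun A : Finset (Fin n) => A ≠ ∅)]
  have h1 : (Finset.univ.filter (fun A : Finset (Fin n) => ¬ (A ≠ ∅))) = {∅} := by
    ext A; simp
  rw [h1]
  simp only [Finset.sum_singleton, Finset.prod_empty, add_sub_cancel_right]
  unfold kerQ
  rw [Finset.mul_sum]
  refine Finset.sum_congr rfl fun A hA => ?_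
  have hc : A.card ≠ 0 := by simpa using hA
  rw [← mul_assoc, ← pow_succ', Finset.prod_mul_distrib, Finset.prod_const]
  have h2 : A.card - 1 + 1 = A.card := by omega
  rw [h2]; rfl

lemma sum_prod_one_add {n : ℕ} (r : ℝ) :
    ∑ ε : Fin n → Bool, ∏ i, (1 + r * rad (ε i)) = 2 ^ n := by
  have := Finset.prod_univ_sum (fun _ : Fin n => (Finset.univ : Finset Bool))
    (fun _ b => 1 + r * rad b)
  rw [Fintype.piFinset_univ] at this
  rw [← this]
  have h : ∑ b : Bool, (1 + r * rad b) = 2 := by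
    simp [rad]; ring
  simp only [h, Finset.prod_const, Finset.card_univ, Fintype.card_fin]

lemma sum_kerQ_le_two_div {n : ℕ} {r : ℝ} (h0 : 0 < r) (h1 : r ≤ 1) :
    ∑ ε : Fin n → Bool, |kerQ r ε| ≤ 2 ^ n * (2 * r⁻¹) := by
  have key : r * ∑ ε : Fin n → Bool, |kerQ r ε| ≤ 2 ^ n * 2 := by
    rw [Finset.mul_sum]
    calc ∑ ε : Fin n → Bool, r * |kerQ r ε|
        ≤ ∑ ε : Fin n → Bool, (∏ i, (1 + r * rad (ε i)) + 1) := by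
          refine Finset.sum_le_sum fun ε _ => ?_
          have e : r * |kerQ r ε| = |r * kerQ r ε| := by rw [abs_mul, abs_of_pos h0]
          rw [e, mul_kerQ]
          have hpos : 0 ≤ ∏ i, (1 + r * rad (ε i)) := by
            refine Finset.prod_nonneg fun i _ => ?_
            cases ε i <;> simp [rad] <;> linarith
          rw [abs_le]; constructor <;> linarith
      _ = 2 ^ n * 2 := by
          rw [Finset.sum_add_distrib, sum_prod_one_add]
          simp; ring
  have : ∑ ε : Fin n → Bool, |kerQ r ε| = r⁻¹ * (r * ∑ ε : Fin n → Bool, |kerQ r ε|) := by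
    field_simp
  rw [this]
  calc _ ≤ r⁻¹ * (2 ^ n * 2) := by gcongr
    _ = _ := by ring

lemma sum_kerQ_le_two_mul {n : ℕ} {r : ℝ} (h0 : 0 < r) (h1 : n * r ≤ 1) :
    ∑ ε : Fin n → Bool, |kerQ r ε| ≤ 2 ^ n * (2 * n) := by
  have : ∀ ε : Fin n → Bool, |kerQ r ε| ≤ 2 * n := by
    intro ε
    have e : r * |kerQ r ε| = |r * kerQ r ε| := by rw [abs_mul, abs_of_pos h0]
    have b := Finset.norm_prod_one_add_sub_one_le Finset.univ (fun i => r * rad (ε i))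
    rw [← mul_kerQ, Real.norm_eq_abs, ← e] at b
    have hs : ∑ i, ‖r * rad (ε i)‖ = n * r := by
      simp [abs_rad, abs_of_pos h0]
    rw [hs] at b
    have hnr : 0 ≤ n * r := by positivity
    have c := Real.abs_exp_sub_one_le (x := n * r) (by rwa [abs_of_nonneg hnr])
    rw [abs_of_nonneg hnr] at c
    have d := (b.trans (le_abs_self _)).trans c
    have : r * |kerQ r ε| ≤ r * (2 * n) := by linarith
    exact le_of_mul_le_mul_left this h0
  calc _ ≤ ∑ ε : Fin n → Bool, (2 * n : ℝ) := Finset.sum_le_sum fun ε _ => this ε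
    _ = _ := by simp

lemma sum_kerL_le {n : ℕ} (hn : 2 ≤ n) :
    ∑ ε : Fin n → Bool, |kerL ε| ≤ 2 ^ n * (5 * Real.log n) := by
  have hn' : (2:ℝ) ≤ n := by exact_mod_cast hn
  have hnp : (0:ℝ) < n := by linarith
  set G : ℝ → ℝ := fun r => ∑ ε : Fin n → Bool, |kerQ r ε| with hG
  have hGc : Continuous G := by
    refine continuous_finset_sum _ fun ε _ => (kerQ_cont ε).abs
  have h1 : ∑ ε : Fin n → Bool, |kerL ε| ≤ ∫ r in (0:ℝ)..1, G r := by
    rw [hG, intervalIntegral.integral_finset_sum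
      (fun ε _ => ((kerQ_cont ε).abs.intervalIntegrable _ _))]
    refine Finset.sum_le_sum fun ε _ => ?_
    rw [kerL_eq]
    exact intervalIntegral.abs_integral_le_integral_abs zero_le_one
  have hi0 : (0:ℝ) < (n:ℝ)⁻¹ := by positivity
  have hi1 : (n:ℝ)⁻¹ ≤ 1 := inv_le_one_of_one_le₀ (by linarith)
  have h2 : ∫ r in (0:ℝ)..1, G r = (∫ r in (0:ℝ)..(n:ℝ)⁻¹, G r) + ∫ r in (n:ℝ)⁻¹..1, G r :=
    (intervalIntegral.integral_add_adjacent_intervals (hGc.intervalIntegrable _ _)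
      (hGc.intervalIntegrable _ _)).symm
  have h3 : ∫ r in (0:ℝ)..(n:ℝ)⁻¹, G r ≤ 2 ^ n * 2 := by
    calc _ ≤ ∫ r in (0:ℝ)..(n:ℝ)⁻¹, (2 ^ n * (2 * n) : ℝ) := by
          refine intervalIntegral.integral_mono_on_of_le_Ioo hi0.le (hGc.intervalIntegrable _ _)
            (by simp) ?_
          intro r hr
          refine sum_kerQ_le_two_mul hr.1 ?_
          calc (n:ℝ) * r ≤ n * (n:ℝ)⁻¹ := by gcongr; exact hr.2.le
            _ = 1 := by field_simp
      _ = _ := by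
          rw [intervalIntegral.integral_const, smul_eq_mul]; field_simp; ring
  have hne : ∀ r ∈ Set.uIcc (n:ℝ)⁻¹ 1, r ≠ 0 := by
    intro r hr
    rw [Set.uIcc_of_le hi1] at hr
    exact (lt_of_lt_of_le hi0 hr.1).ne'
  have h4 : ∫ r in (n:ℝ)⁻¹..1, G r ≤ 2 ^ n * (2 * Real.log n) := by
    calc _ ≤ ∫ r in (n:ℝ)⁻¹..1, 2 ^ n * (2 * r⁻¹) := by
          refine intervalIntegral.integral_mono_on hi1 (hGc.intervalIntegrable _ _)
            ?_ ?_
          · refine ContinuousOn.intervalIntegrable ?_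
            exact continuousOn_const.mul (continuousOn_const.mul
              (continuousOn_id.inv₀ hne))
          · intro r hr
            exact sum_kerQ_le_two_div (lt_of_lt_of_le hi0 hr.1) hr.2
      _ = _ := by
          rw [intervalIntegral.integral_const_mul, intervalIntegral.integral_const_mul,
            integral_inv_of_pos hi0 one_pos]
          simp
  have hlog : (2:ℝ) ≤ 3 * Real.log n := by
    have := Real.log_le_log (by norm_num) hn'
    have := Real.log_two_gt_d9
    linarith
  have h5 : (0:ℝ) < 2 ^ n := by positivity
  nlinarith

lemma lapPow_eq {n : ℕ} {X : Type*} [NormedAddCommGroup X] [NormedSpace ℝ X]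
    (g : (Fin n → Bool) → X) (ε : Fin n → Bool) :
    lapPow (-1) g ε = ((2 ^ n : ℝ)⁻¹) • ∑ η : Fin n → Bool, kerL η • g (mulPt η ε) := by
  have h1 : ∑ η : Fin n → Bool, kerL η • g (mulPt η ε)
      = ∑ η : Fin n → Bool, kerL (mulPt ε η) • g η := by
    rw [← Equiv.sum_comp (mulEquiv ε)]
    refine Finset.sum_congr rfl fun η _ => ?_
    show kerL (mulPt ε η) • g (mulPt (mulPt ε η) ε) = _
    rw [mulPt_comm (mulPt ε η) ε, mulPt_mulPt]
  rw [h1]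
  unfold lapPow wcoef cubeAvg kerL
  simp only [Finset.sum_smul, Finset.smul_sum, smul_smul]
  rw [Finset.sum_comm]
  refine Finset.sum_congr rfl fun η _ => Finset.sum_congr rfl fun A _ => ?_
  rw [walshChar_mulPt, Real.rpow_neg_one]
  congr 1; ring

section Norm

variable {n : ℕ} {X : Type*} [NormedAddCommGroup X] [NormedSpace ℝ X]

/-- Unnormalized `L_p` norm on the cube. -/
def NN (p : ℝ) (f : (Fin n → Bool) → X) : ℝ := (∑ ε, ‖f ε‖ ^ p) ^ (1 / p)

lemma NN_eq {p : ℝ} (hp : 1 ≤ p) (f : (Fin n → Bool) → X) :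
    NN p f = ‖(WithLp.toLp (ENNReal.ofReal p) f : PiLp (ENNReal.ofReal p) fun _ => X)‖ := by
  have h : (ENNReal.ofReal p).toReal = p := ENNReal.toReal_ofReal (by linarith)
  rw [PiLp.norm_eq_sum (by rw [h]; linarith), h]
  rfl

lemma NN_nonneg (p : ℝ) (f : (Fin n → Bool) → X) : 0 ≤ NN p f := by
  unfold NN; positivity

lemma NN_sum_smul {p : ℝ} (hp : 1 ≤ p) {ι : Type*} (s : Finset ι) (a : ι → ℝ)
    (f : ι → (Fin n → Bool) → X) :
    NN p (fun ε => ∑ i ∈ s, a i • f i ε) ≤ ∑ i ∈ s, |a i| * NN p (f i) := by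
  haveI : Fact (1 ≤ ENNReal.ofReal p) := ⟨by simpa using hp⟩
  have e : (WithLp.toLp (ENNReal.ofReal p) (fun ε => ∑ i ∈ s, a i • f i ε) :
      PiLp (ENNReal.ofReal p) fun _ => X)
      = ∑ i ∈ s, a i • WithLp.toLp (ENNReal.ofReal p) (f i) := by
    ext ε
    simp
  rw [NN_eq hp, e]
  refine (norm_sum_le _ _).trans (Finset.sum_le_sum fun i _ => ?_)
  rw [norm_smul, NN_eq hp, Real.norm_eq_abs]

lemma NN_comp (p : ℝ) (f : (Fin n → Bool) → X) (e : (Fin n → Bool) ≃ (Fin n → Bool)) :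
    NN p (fun ε => f (e ε)) = NN p f := by
  unfold NN
  rw [Equiv.sum_comp e (fun ε => ‖f ε‖ ^ p)]

lemma NN_lapPow {p : ℝ} (hp : 1 ≤ p) (hn : 2 ≤ n) (g : (Fin n → Bool) → X) :
    NN p (lapPow (-1) g) ≤ 5 * Real.log n * NN p g := by
  have e : lapPow (-1) g = fun ε => ∑ η : Fin n → Bool,
      (((2 ^ n : ℝ)⁻¹) * kerL η) • g (mulEquiv η ε) := by
    funext ε
    rw [lapPow_eq, Finset.smul_sum]
    simp only [smul_smul]
    rfl
  rw [e]
  refine (NN_sum_smul hp _ _ _).trans ?_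
  simp only [NN_comp]
  rw [← Finset.sum_mul]
  refine mul_le_mul_of_nonneg_right ?_ (NN_nonneg _ _)
  simp only [abs_mul]
  rw [← Finset.mul_sum, abs_of_pos (by positivity)]
  calc _ ≤ (2 ^ n : ℝ)⁻¹ * (2 ^ n * (5 * Real.log n)) := by
        gcongr; exact sum_kerL_le hn
    _ = _ := by field_simp

lemma NN_Dop {p : ℝ} (hp : 1 ≤ p) (j : Fin n) (g : (Fin n → Bool) → X) :
    NN p (Dop j g) ≤ NN p g := by
  have e : Dop j g = fun ε => ∑ b : Bool, (2⁻¹ * rad b) •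
      (fun (b : Bool) ε => if b then g ε else g (flipEquiv j ε)) b ε := by
    funext ε
    simp [Dop, rad, smul_sub, flipEquiv, sub_eq_add_neg]
  rw [e]
  refine (NN_sum_smul hp _ _ _).trans ?_
  simp only [Fintype.sum_bool, if_true, Bool.false_eq_true, if_false, NN_comp, abs_mul, abs_rad]
  rw [abs_of_pos (by norm_num)]
  linarith

lemma NN_avg {p : ℝ} (hp : 1 ≤ p) (j : Fin n) (F : (Fin n → Bool) → (Fin n → Bool) → X) :
    NN p (fun ε' => cubeAvg (fun δ : Fin n → Bool => rad (δ j) • F ε' δ)) ≤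
      ((2 ^ n : ℝ)⁻¹ * ∑ δ, ∑ ε, ‖F ε δ‖ ^ p) ^ (1 / p) := by
  have e : (fun ε' => cubeAvg (fun δ : Fin n → Bool => rad (δ j) • F ε' δ)) =
      fun ε' => ∑ δ : Fin n → Bool, ((2 ^ n : ℝ)⁻¹ * rad (δ j)) • (fun δ ε => F ε δ) δ ε' := by
    funext ε
    simp [cubeAvg, Finset.smul_sum, smul_smul]
  rw [e]
  refine (NN_sum_smul hp _ _ _).trans ?_
  simp only [abs_mul, abs_rad, mul_one]
  rw [abs_of_pos (by positivity)]
  have := Real.arith_mean_le_rpow_mean (Finset.univ : Finset (Fin n → Bool))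
    (fun _ => (2 ^ n : ℝ)⁻¹) (fun δ => NN p (fun ε => F ε δ)) (fun _ _ => by positivity)
    (by simp) (fun δ _ => NN_nonneg _ _) hp
  refine this.trans (le_of_eq ?_)
  rw [Finset.mul_sum]
  congr 1
  refine Finset.sum_congr rfl fun δ _ => ?_
  unfold NN
  rw [← Real.rpow_mul (by positivity), one_div, inv_mul_cancel₀ (by linarith), Real.rpow_one]

end Norm

/-- generalized Pisier inequality with constant `C(p)·n·log n` for an
arbitrary Banach space. -/
theorem general_pisier_nlogn.{u} (p : ℝ) (hp : 1 ≤ p) :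
    ∃ C : ℝ, ∀ (n : ℕ), 2 ≤ n →
      ∀ (X : Type u) [NormedAddCommGroup X] [NormedSpace ℝ X] [CompleteSpace X]
        (F : (Fin n → Bool) → (Fin n → Bool) → X),
        (cubeAvg (fun ε =>
            ‖∑ j, lapPow (-1)
              (Dop j (fun ε' => cubeAvg (fun δ : Fin n → Bool => rad (δ j) • F ε' δ))) ε‖
            ^ p)) ^ (1 / p) ≤
          C * n * Real.log n * (cubeAvg (fun δ : Fin n → Bool => cubeAvg (fun ε =>
            ‖F ε δ‖ ^ p))) ^ (1 / p) := by
  refine ⟨5, fun n hn X _ _ _ F => ?_⟩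
  set S : ℝ := ((2 ^ n : ℝ)⁻¹ * ∑ δ, ∑ ε, ‖F ε δ‖ ^ p) ^ (1 / p) with hS
  have hlog : 0 ≤ Real.log n := Real.log_natCast_nonneg n
  have key : NN p (fun ε => ∑ j, lapPow (-1)
      (Dop j (fun ε' => cubeAvg (fun δ : Fin n → Bool => rad (δ j) • F ε' δ))) ε)
      ≤ 5 * n * Real.log n * S := by
    have h := NN_sum_smul hp (Finset.univ : Finset (Fin n)) (fun _ => (1:ℝ))
      (fun j => lapPow (-1)
        (Dop j (fun ε' => cubeAvg (fun δ : Fin n → Bool => rad (δ j) • F ε' δ))))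
    simp only [one_smul, abs_one, one_mul] at h
    refine h.trans ?_
    calc _ ≤ ∑ _j : Fin n, 5 * Real.log n * S := by
          refine Finset.sum_le_sum fun j _ => (NN_lapPow hp hn _).trans ?_
          have := (NN_Dop hp j _).trans (NN_avg hp j F)
          gcongr
      _ = _ := by simp; ring
  have hc : (0:ℝ) ≤ (2 ^ n : ℝ)⁻¹ := by positivity
  simp only [cubeAvg, smul_eq_mul] at key ⊢
  rw [Real.mul_rpow hc (by positivity), ← Finset.mul_sum, Real.mul_rpow hc (by positivity)]
  calc _ ≤ ((2 ^ n : ℝ)⁻¹) ^ (1 / p) * (5 * n * Real.log n * S) := by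
        gcongr
        exact key
    _ = _ := by rw [hS]; ring

end
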